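/- In a q-topos, for every object A the power object PA, i.e. the representing object of the presheaf X ↦ StrongSub(X × A), is coarse. -/

import Mathlib

open CategoryTheory CategoryTheory.Limits

universe w v u

namespace QToposPaper

variable {C : Type u} [Category.{v} C]

/-- A morphism `g` is left orthogonal to a morphism `m` if every commuting square from `g`
to `m` admits a unique diagonal filler. -/
def LeftOrthogonal {A B X Y : C} (g : A ⟶ B) (m : X ⟶ Y) : Prop :=
  ∀ (u : A ⟶ X) (v : B ⟶ Y), u ≫ m = g ≫ v →
    ∃! l : B ⟶ X, g ≫ l = u ∧ l ≫ m = v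

/-- `t : U ⟶ Ω` is a generic strong monomorphism (i.e. a representation of the presheaf of
strong subobjects, phrased via its universal element): `t` is a strong monomorphism and every
strong monomorphism is a pullback of `t` along a unique classifying map. -/
def IsStrongSubClassifier {U Ω : C} (t : U ⟶ Ω) : Prop :=
  StrongMono t ∧
    ∀ {S X : C} (m : S ⟶ X), StrongMono m →
      ∃! χ : X ⟶ Ω, ∃ top : S ⟶ U, IsPullback top m t χ

/-- `mem : E ⟶ P ⨯ A` exhibits `P` as a representing object for the presheaf
`X ↦ StrongSub (X ⨯ A)`, phrased via its universal element: every strong monomorphism into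
`X ⨯ A` is a pullback of `mem` along a unique map `X ⟶ P`. -/
def IsWeakPowerObject [HasBinaryProducts C] (A : C) {P E : C} (mem : E ⟶ P ⨯ A) : Prop :=
  StrongMono mem ∧
    ∀ {S X : C} (m : S ⟶ X ⨯ A), StrongMono m →
      ∃! χ : X ⟶ P, ∃ top : S ⟶ E, IsPullback top m mem (prod.map χ (𝟙 A))

/-- `mem : E ⟶ P ⨯ A` exhibits `P` as a power object of `A`: every monomorphism into
`X ⨯ A` is a pullback of `mem` along a unique map `X ⟶ P`. -/
def IsPowerObject [HasBinaryProducts C] (A : C) {P E : C} (mem : E ⟶ P ⨯ A) : Prop :=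
  Mono mem ∧
    ∀ {S X : C} (m : S ⟶ X ⨯ A), Mono m →
      ∃! χ : X ⟶ P, ∃ top : S ⟶ E, IsPullback top m mem (prod.map χ (𝟙 A))

/-- `t : U ⟶ Ω` is a subobject classifier: every monomorphism is a pullback of `t` along a
unique classifying map. -/
def IsMonoClassifier {U Ω : C} (t : U ⟶ Ω) : Prop :=
  Mono t ∧
    ∀ {S X : C} (m : S ⟶ X), Mono m →
      ∃! χ : X ⟶ Ω, ∃ top : S ⟶ U, IsPullback top m t χ

/-- An object `Ω` is exponentiating if for every object `X` the presheaf `C(- ⨯ X, Ω)` is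
representable (phrased via a universal element `ev`). -/
def IsExponentiating [HasBinaryProducts C] (Ω : C) : Prop :=
  ∀ X : C, ∃ (E : C) (ev : E ⨯ X ⟶ Ω), ∀ {Y : C} (f : Y ⨯ X ⟶ Ω),
    ∃! g : Y ⟶ E, prod.map g (𝟙 X) ≫ ev = f

/-- A strong equivalence relation on `A`: a pair `r₁ r₂ : R ⟶ A` such that
`⟨r₁, r₂⟩ : R ⟶ A ⨯ A` is a strong monomorphism which is an internal equivalence relation. -/
structure IsStrongEquivRel [HasBinaryProducts C] [HasPullbacks C]
    {R A : C} (r₁ r₂ : R ⟶ A) : Prop where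
  strongMono : StrongMono (prod.lift r₁ r₂)
  refl : ∃ d : A ⟶ R, d ≫ r₁ = 𝟙 A ∧ d ≫ r₂ = 𝟙 A
  symm : ∃ s : R ⟶ R, s ≫ r₁ = r₂ ∧ s ≫ r₂ = r₁
  trans : ∃ t : pullback r₂ r₁ ⟶ R,
    t ≫ r₁ = pullback.fst r₂ r₁ ≫ r₁ ∧ t ≫ r₂ = pullback.snd r₂ r₁ ≫ r₂

/-- `r₁, r₂` admits an effective quotient: a coequalizer `e` of `r₁, r₂` whose kernel pair
is `(r₁, r₂)`. -/
def HasEffectiveQuotient {R A : C} (r₁ r₂ : R ⟶ A) : Prop :=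
  ∃ (Q : C) (e : A ⟶ Q) (w : r₁ ≫ e = r₂ ≫ e),
    Nonempty (IsColimit (Cofork.ofπ e w)) ∧ IsPullback r₁ r₂ e e

/-- A q-topos: a category with finite limits such that (i) for every object `A` the presheaf
`X ↦ StrongSub (X ⨯ A)` is representable, (ii) every strong equivalence relation has an
effective quotient, and (iii) regular epimorphisms are stable under pullback. -/
class QTopos (C : Type u) [Category.{v} C] [HasFiniteLimits C] : Prop where
  weakPowerObject : ∀ A : C, ∃ (P E : C) (mem : E ⟶ P ⨯ A), IsWeakPowerObject A mem
  effectiveQuotient : ∀ {R A : C} (r₁ r₂ : R ⟶ A),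
    IsStrongEquivRel r₁ r₂ → HasEffectiveQuotient r₁ r₂
  regularEpiStable : ∀ {P X Y Z : C} (p : P ⟶ X) (q : P ⟶ Z) (f : X ⟶ Y) (g : Z ⟶ Y),
    IsPullback p q f g → Nonempty (RegularEpi g) → Nonempty (RegularEpi p)

/-- The poset of strong subobjects of `X`. -/
def StrongSub (X : C) : Type (max u v) := { S : Subobject X // StrongMono S.arrow }

instance (X : C) : PartialOrder (StrongSub X) := Subtype.partialOrder _

/-- An object `X` is coarse if every morphism into `X` extends (necessarily uniquely) along
any morphism which is simultaneously a monomorphism and an epimorphism. -/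
def Coarse (X : C) : Prop :=
  ∀ {A B : C} (f : A ⟶ B), Mono f → Epi f → ∀ g : A ⟶ X, ∃ h : B ⟶ X, f ≫ h = g

end QToposPaper

open QToposPaper CategoryTheory CategoryTheory.Limits

namespace QToposPaper

attribute [local simp] prod.lift_fst prod.lift_snd prod.lift_fst_assoc prod.lift_snd_assoc

lemma strongMono_of_isPullback {C : Type u} [Category.{v} C] {S X T Y : C}
    {t : S ⟶ T} {m : S ⟶ X} {n : T ⟶ Y} {f : X ⟶ Y} (hp : IsPullback t m n f)
    (hn : StrongMono n) : StrongMono m := by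
  have := hn.mono
  refine ⟨⟨fun a b hab => hp.hom_ext ?_ hab⟩, ?_⟩
  · rw [← cancel_mono n, Category.assoc, Category.assoc, hp.w, reassoc_of% hab]
  · intro A B z hz
    have := hn.rlp z
    exact ⟨fun {u v} sq => by
      have sq' : CommSq (u ≫ t) z n (v ≫ f) :=
        ⟨by rw [Category.assoc, hp.w, ← Category.assoc, sq.w, Category.assoc]⟩
      refine ⟨⟨⟨hp.lift sq'.lift v sq'.fac_right, ?_, ?_⟩⟩⟩
      · apply hp.hom_ext
        · simp
        · simp [sq.w]
      · simp⟩

/-- Every strong subobject extends along any monomorphism. -/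
lemma exists_extension {C : Type u} [Category.{v} C] [HasFiniteLimits C] [QTopos C]
    {S X Z : C} (i : S ⟶ X) (F : X ⟶ Z) (hi : StrongMono i) (hF : Mono F) :
    ∃ (T : C) (n : T ⟶ Z) (t : S ⟶ T), StrongMono n ∧ IsPullback t i n F := by
  obtain ⟨Q, E, mem, hmem, hc⟩ := QTopos.weakPowerObject X
  have := hi
  have := hi.mono
  have hsb : IsSplitMono (prod.lift F (𝟙 X)) := ⟨⟨⟨prod.snd, by simp⟩⟩⟩
  have hb : StrongMono (prod.lift F (𝟙 X)) := inferInstance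
  have ha : StrongMono (i ≫ prod.lift F (𝟙 X)) := strongMono_comp _ _
  have hsc : IsSplitMono (prod.lift (𝟙 S) i) := ⟨⟨⟨prod.fst, by simp⟩⟩⟩
  have hd : StrongMono (prod.lift (𝟙 S) i) := inferInstance
  obtain ⟨a, ⟨ta, pa⟩, -⟩ := hc _ ha
  obtain ⟨b, ⟨tb, pb⟩, -⟩ := hc _ hb
  have qa : IsPullback (𝟙 S) (prod.lift (𝟙 S) i) (i ≫ prod.lift F (𝟙 X))
      (prod.map (i ≫ F) (𝟙 X)) := by
    refine ⟨⟨by ext <;> simp⟩, ⟨PullbackCone.IsLimit.mk _ (fun s => s.fst) ?_ ?_ ?_⟩⟩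
    · intro s; simp
    · intro s
      have h1 := s.condition =≫ prod.fst
      have h2 := s.condition =≫ prod.snd
      simp at h1 h2
      ext
      · simp only [← Category.assoc, cancel_mono] at h1
        simpa using h1
      · simpa using h2
    · intro s m h1 h2
      simpa using h1
  have qb : IsPullback i (prod.lift (𝟙 S) i) (prod.lift F (𝟙 X))
      (prod.map (i ≫ F) (𝟙 X)) := by
    refine ⟨⟨by ext <;> simp⟩, ⟨PullbackCone.IsLimit.mk _ (fun s => s.snd ≫ prod.fst) ?_ ?_ ?_⟩⟩
    · intro s
      have h1 := s.condition =≫ prod.fst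
      simp at h1
      simp only [← Category.assoc, cancel_mono] at h1
      simpa using h1.symm
    · intro s
      have h1 := s.condition =≫ prod.fst
      have h2 := s.condition =≫ prod.snd
      simp at h1 h2
      simp only [← Category.assoc, cancel_mono] at h1
      ext
      · simp
      · simp [← h2, h1]
    · intro s m h1 h2
      simp [← h2]
  have key : i ≫ F ≫ a = i ≫ F ≫ b := by
    refine (hc _ hd).unique ⟨𝟙 S ≫ ta, ?_⟩ ⟨i ≫ tb, ?_⟩
    · have := qa.paste_horiz pa
      simpa [prod.map_map] using this
    · have := qb.paste_horiz pb
      simpa [prod.map_map] using this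
  refine ⟨equalizer a b, equalizer.ι a b, equalizer.lift (i ≫ F) (by simpa using key),
    inferInstance, ⟨⟨by simp⟩, ?_⟩⟩
  have fac : ∀ (s : PullbackCone (equalizer.ι a b) F), ∃ l : s.pt ⟶ S, l ≫ i = s.snd := by
    intro s
    have e : s.snd ≫ F ≫ a = s.snd ≫ F ≫ b := by
      rw [← Category.assoc, ← Category.assoc, ← s.condition, Category.assoc, Category.assoc,
        equalizer.condition]
    have w : (s.snd ≫ tb) ≫ mem = prod.lift (s.snd ≫ F) s.snd ≫ prod.map a (𝟙 X) := by
      rw [Category.assoc, pb.w]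
      ext <;> simp [e]
    refine ⟨pa.lift _ _ w, ?_⟩
    have := pa.lift_snd _ _ w =≫ prod.snd
    simpa using this
  choose l hl using fac
  refine ⟨PullbackCone.IsLimit.mk _ l ?_ hl ?_⟩
  · intro s
    rw [← cancel_mono (equalizer.ι a b)]
    simp [reassoc_of% (hl s), s.condition]
  · intro s m h1 h2
    rw [← cancel_mono i, h2, hl]

end QToposPaper

/-- In a q-topos, for every object `A` the power object `P A`, i.e. the representing object
of the presheaf `X ↦ StrongSub (X ⨯ A)`, is coarse. -/
theorem weakPowerObject_coarse
    {C : Type u} [Category.{v} C] [HasFiniteLimits C] [QTopos C]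
    (A : C) {P E : C} (mem : E ⟶ P ⨯ A) (h : IsWeakPowerObject A mem) :
    Coarse P := by
  intro X Y f hf _ g
  obtain ⟨hmem, hc⟩ := h
  have pg := IsPullback.of_hasPullback mem (prod.map g (𝟙 A))
  have hi := strongMono_of_isPullback pg hmem
  obtain ⟨T, n, t, hn, pt⟩ := exists_extension _ (prod.map f (𝟙 A)) hi inferInstance
  obtain ⟨k, ⟨tk, pk⟩, -⟩ := hc n hn
  refine ⟨k, (hc _ hi).unique ⟨t ≫ tk, ?_⟩ ⟨_, pg⟩⟩
  have := pt.paste_horiz pk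
  simpa [prod.map_map] using this
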